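/- For positive integers a, b, n with floor(n/a) = floor(n/b) and a ≠ b, we have a·b > n. -/

import Mathlib

theorem Nat.lt_mul_of_div_eq_div_of_lt {a b n : ℕ} (ha : 0 < a) (h : n / a = n / b)
    (hab : a < b) : n < a * b := by
  by_contra! hle
  have hq : b ≤ n / a := (Nat.le_div_iff_mul_le ha).2 (by rwa [mul_comm])
  have hlt : n < a * (n / a + 1) := Nat.lt_mul_div_succ n ha
  have hge : b * (n / a) ≤ n := h ▸ Nat.mul_div_le n b
  nlinarith [Nat.mul_le_mul_right (n / a) (Nat.succ_le_of_lt hab)]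

theorem stmt_0 (a b n : ℕ) (ha : 0 < a) (hb : 0 < b) (hn : 0 < n)
    (h : n / a = n / b) (hab : a ≠ b) : n < a * b := by
  rcases lt_or_gt_of_ne hab with hlt | hlt
  · exact Nat.lt_mul_of_div_eq_div_of_lt ha h hlt
  · exact mul_comm b a ▸ Nat.lt_mul_of_div_eq_div_of_lt hb h.symm hlt
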